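/- Diagonalization claim: Let 𝒱 and 𝒯 be sets, and for each T ∈ 𝒯 let bags(T) be a nonempty set of subsets of 𝒱. Let ℳ be the set of all functions β : 𝒯 → 2^𝒱 with β(T) ∈ bags(T) for every T ∈ 𝒯, and let 𝐁 = { range(β) : β ∈ ℳ } (a set of sets of subsets of 𝒱). Then for every choice function c assigning to each 𝓑 ∈ 𝐁 an element c(𝓑) ∈ 𝓑, there exists T ∈ 𝒯 such that bags(T) ⊆ { c(𝓑) : 𝓑 ∈ 𝐁 }. -/

import Mathlib

/-- Diagonalization claim: if `c` chooses an element from each set `range β` (for `β` a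
bag-choice function with `β t ∈ bags t` for all `t`), then the chosen bags cover all bags of
some single `t ∈ 𝒯`. -/
theorem diagonalization_claim
    {V T : Type*} (bags : T → Set (Set V)) (hne : ∀ t : T, (bags t).Nonempty)
    (c : Set (Set V) → Set V)
    (hc : ∀ B : Set (Set V),
      (∃ β : T → Set V, (∀ t : T, β t ∈ bags t) ∧ B = Set.range β) → c B ∈ B) :
    ∃ t : T, bags t ⊆
      { S : Set V | ∃ β : T → Set V, (∀ t' : T, β t' ∈ bags t') ∧ S = c (Set.range β) } := by
  by_contra! h
  simp only [Set.not_subset] at h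
  choose β hβ hnot using h
  obtain ⟨t, ht⟩ := hc (Set.range β) ⟨β, hβ, rfl⟩
  exact hnot t ⟨β, hβ, ht⟩
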